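/- The complex Hermite polynomials H^α_{m,p}(z, z̄) = (-1)^{m+p} e^{α|z|²} ∂_z^m ∂_{z̄}^p (e^{−α|z|²}), with α > 0, satisfy the orthogonality relation ∫_ℂ H^α_{m,p}(z,z̄) · conj(H^α_{m',p'}(z,z̄)) · e^{−α|z|²} dA(z) = π α^{p+m−1} m! p! δ_{m,m'} δ_{p,p'} for all m, p, m', p' ∈ ℕ. -/

import Mathlib

open Complex Nat MeasureTheory

/-- Wirtinger derivative `∂_z`. -/
noncomputable def wirtingerZ : (ℂ → ℂ) → (ℂ → ℂ) := fun f z =>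
  (1 / 2 : ℂ) * (fderiv ℝ f z 1 - Complex.I * fderiv ℝ f z Complex.I)

/-- Anti-Wirtinger derivative `∂_z̄`. -/
noncomputable def wirtingerZBar : (ℂ → ℂ) → (ℂ → ℂ) := fun f z =>
  (1 / 2 : ℂ) * (fderiv ℝ f z 1 + Complex.I * fderiv ℝ f z Complex.I)

/-- Complex Hermite polynomials
`H^α_{m,p}(z, z̄) = (-1)^{m+p} e^{α|z|²} ∂_z^m ∂_z̄^p e^{-α|z|²}`. -/
noncomputable def cHermite (α : ℝ) (m p : ℕ) (z : ℂ) : ℂ :=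
  (-1) ^ (m + p) * Complex.exp ((α : ℂ) * (z * (starRingEnd ℂ) z))
    * (wirtingerZ^[m] (wirtingerZBar^[p]
        (fun w => Complex.exp (-(α : ℂ) * (w * (starRingEnd ℂ) w))))) z

open MvPolynomial in
/-- evaluation at `(z, z̄)` -/
noncomputable def evz (z : ℂ) : MvPolynomial (Fin 2) ℂ →+* ℂ :=
  MvPolynomial.eval ![z, (starRingEnd ℂ) z]

lemma evz_C (z a : ℂ) : evz z (MvPolynomial.C a) = a := by simp [evz]
lemma evz_X0 (z : ℂ) : evz z (MvPolynomial.X 0) = z := by simp [evz]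
lemma evz_X1 (z : ℂ) : evz z (MvPolynomial.X 1) = (starRingEnd ℂ) z := by simp [evz]

/-- derivative of the evaluation -/
lemma hasFDerivAt_evz (P : MvPolynomial (Fin 2) ℂ) (z : ℂ) :
    HasFDerivAt (fun w => evz w P)
      (evz z (MvPolynomial.pderiv 0 P) • (ContinuousLinearMap.id ℝ ℂ)
        + evz z (MvPolynomial.pderiv 1 P) • (Complex.conjCLE : ℂ →L[ℝ] ℂ)) z := by
  induction P using MvPolynomial.induction_on with
  | C a => 
    refine (hasFDerivAt_const (𝕜 := ℝ) (evz z (MvPolynomial.C a)) z).congr_of_eventuallyEq ?_ |>.congr_fderiv ?_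
    · exact Filter.Eventually.of_forall fun w => by simp [evz]
    · ext v <;> simp
  | add P Q hP hQ =>
    simp only [map_add]
    refine (hP.add hQ).congr_fderiv ?_
    ext v <;> simp <;> ring
  | mul_X P i hP =>
    have hX : HasFDerivAt (fun w => evz w (MvPolynomial.X i))
      (evz z (MvPolynomial.pderiv 0 (MvPolynomial.X i)) • (ContinuousLinearMap.id ℝ ℂ)
        + evz z (MvPolynomial.pderiv 1 (MvPolynomial.X i)) • (Complex.conjCLE : ℂ →L[ℝ] ℂ)) z := by
      fin_cases i
      · have h := hasFDerivAt_id (𝕜 := ℝ) z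
        simp only [evz]
        simp
        refine h.congr_fderiv ?_
        ext v <;> simp
      · have h := (Complex.conjCLE : ℂ →L[ℝ] ℂ).hasFDerivAt (x := z)
        simp only [evz]
        simp
        refine h.congr_fderiv ?_
        ext v <;> simp
    simp only [map_mul]
    refine (hP.mul hX).congr_fderiv ?_
    rw [Derivation.leibniz, Derivation.leibniz]
    simp only [map_add, smul_eq_mul, map_mul]
    ext v <;> simp <;> ring

/-- the Gaussian weight -/
noncomputable def gw (α : ℝ) (z : ℂ) : ℂ :=
  Complex.exp (-(α : ℂ) * (z * (starRingEnd ℂ) z))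

lemma hasFDerivAt_gw (α : ℝ) (z : ℂ) :
    HasFDerivAt (gw α)
      ((-(α:ℂ) * (starRingEnd ℂ) z * gw α z) • (ContinuousLinearMap.id ℝ ℂ)
        + (-(α:ℂ) * z * gw α z) • (Complex.conjCLE : ℂ →L[ℝ] ℂ)) z := by
  have h := hasFDerivAt_evz
    (MvPolynomial.C (-(α:ℂ)) * (MvPolynomial.X 0 * MvPolynomial.X 1)) z
  have h2 := h.cexp
  have e : (fun w => Complex.exp (evz w
      (MvPolynomial.C (-(α:ℂ)) * (MvPolynomial.X 0 * MvPolynomial.X 1)))) = gw α := by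
    funext w; simp [evz, gw]
  rw [e] at h2
  refine h2.congr_fderiv ?_
  simp [Derivation.leibniz, map_add, smul_eq_mul, map_mul, evz_C, evz_X0, evz_X1,
    MvPolynomial.pderiv_C, MvPolynomial.pderiv_X, gw]
  ext v <;> simp <;> ring

/-- raising operator -/
noncomputable def D0 (α : ℝ) (P : MvPolynomial (Fin 2) ℂ) : MvPolynomial (Fin 2) ℂ :=
  MvPolynomial.C (α:ℂ) * MvPolynomial.X 1 * P - MvPolynomial.pderiv 0 P

noncomputable def D1 (α : ℝ) (P : MvPolynomial (Fin 2) ℂ) : MvPolynomial (Fin 2) ℂ :=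
  MvPolynomial.C (α:ℂ) * MvPolynomial.X 0 * P - MvPolynomial.pderiv 1 P

lemma wZ_evz (α : ℝ) (P : MvPolynomial (Fin 2) ℂ) :
    wirtingerZ (fun w => evz w P * gw α w) = fun w => evz w (-D0 α P) * gw α w := by
  funext z
  have h : fderiv ℝ (fun w => evz w P * gw α w) z = _ :=
    ((hasFDerivAt_evz P z).mul (hasFDerivAt_gw α z)).fderiv
  simp only [wirtingerZ, h, D0, map_sub, map_mul, map_neg, evz_C, evz_X1]
  simp
  linear_combination (-1/2 * (evz z P * ((α:ℂ) * z * gw α z - (α:ℂ) * (starRingEnd ℂ) z * gw α z)+ gw α z * (evz z (MvPolynomial.pderiv 0 P) -evz z (MvPolynomial.pderiv 1 P) ))) * Complex.I_mul_I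

lemma wZBar_evz (α : ℝ) (P : MvPolynomial (Fin 2) ℂ) :
    wirtingerZBar (fun w => evz w P * gw α w) = fun w => evz w (-D1 α P) * gw α w := by
  funext z
  have h : fderiv ℝ (fun w => evz w P * gw α w) z = _ :=
    ((hasFDerivAt_evz P z).mul (hasFDerivAt_gw α z)).fderiv
  simp only [wirtingerZBar, h, D1, map_sub, map_mul, map_neg, evz_C, evz_X0]
  simp
  linear_combination (1/2 * (evz z P * ((α:ℂ) * z * gw α z - (α:ℂ) * (starRingEnd ℂ) z * gw α z)+ gw α z * (evz z (MvPolynomial.pderiv 0 P) -evz z (MvPolynomial.pderiv 1 P) ))) * Complex.I_mul_I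

lemma D0_smul (α : ℝ) (c : ℂ) (P : MvPolynomial (Fin 2) ℂ) :
    D0 α (MvPolynomial.C c * P) = MvPolynomial.C c * D0 α P := by
  simp [D0, Derivation.leibniz]; ring

lemma D1_smul (α : ℝ) (c : ℂ) (P : MvPolynomial (Fin 2) ℂ) :
    D1 α (MvPolynomial.C c * P) = MvPolynomial.C c * D1 α P := by
  simp [D1, Derivation.leibniz]; ring

lemma wZ_iter (α : ℝ) (m : ℕ) (P : MvPolynomial (Fin 2) ℂ) :
    wirtingerZ^[m] (fun w => evz w P * gw α w)
      = fun w => evz w (MvPolynomial.C ((-1)^m) * (D0 α)^[m] P) * gw α w := by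
  induction m with
  | zero => simp
  | succ n ih =>
    rw [Function.iterate_succ_apply', ih, wZ_evz, D0_smul, Function.iterate_succ_apply']
    funext w
    simp only [map_neg, map_mul, evz_C]
    ring

lemma wZBar_iter (α : ℝ) (p : ℕ) :
    wirtingerZBar^[p] (gw α)
      = fun w => evz w (MvPolynomial.C ((-1)^p) * 
        (MvPolynomial.C ((α:ℂ)^p) * MvPolynomial.X 0 ^ p)) * gw α w := by
  induction p with
  | zero => simp
  | succ n ih =>
    rw [Function.iterate_succ_apply', ih, wZBar_evz]
    funext w
    rw [D1_smul, D1_smul]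
    simp [D1, evz_C, evz_X0, Derivation.leibniz_pow, MvPolynomial.pderiv_X]
    ring

/-- the polynomial of `cHermite` -/
noncomputable def hP (α : ℝ) (m p : ℕ) : MvPolynomial (Fin 2) ℂ :=
  (D0 α)^[m] (MvPolynomial.C ((α:ℂ)^p) * MvPolynomial.X 0 ^ p)

noncomputable def gP (α : ℝ) (m p : ℕ) : MvPolynomial (Fin 2) ℂ :=
  (D1 α)^[m] (MvPolynomial.C ((α:ℂ)^p) * MvPolynomial.X 1 ^ p)

lemma D0_iter_smul (α : ℝ) (m : ℕ) (c : ℂ) (P : MvPolynomial (Fin 2) ℂ) :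
    (D0 α)^[m] (MvPolynomial.C c * P) = MvPolynomial.C c * (D0 α)^[m] P := by
  induction m with
  | zero => simp
  | succ n ih => rw [Function.iterate_succ_apply', ih, D0_smul, Function.iterate_succ_apply']

lemma cHermite_eq (α : ℝ) (m p : ℕ) (z : ℂ) : cHermite α m p z = evz z (hP α m p) := by
  have h : (wirtingerZ^[m] (wirtingerZBar^[p] (gw α))) z
      = (-1)^m * ((-1)^p * evz z (hP α m p)) * gw α z := by
    rw [wZBar_iter, wZ_iter, D0_iter_smul, hP]
    simp only [map_mul, evz_C]
  have e : Complex.exp ((α : ℂ) * (z * (starRingEnd ℂ) z)) * gw α z = 1 := by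
    rw [gw, ← Complex.exp_add]; simp
  have e2 : ((-1:ℂ)^m)*(-1)^m = 1 := by rw [← mul_pow]; simp
  have e3 : ((-1:ℂ)^p)*(-1)^p = 1 := by rw [← mul_pow]; simp
  unfold cHermite
  change (-1) ^ (m + p) * Complex.exp ((α : ℂ) * (z * (starRingEnd ℂ) z)) *
    (wirtingerZ^[m] (wirtingerZBar^[p] (gw α))) z = _
  rw [h, pow_add]
  calc _ = (((-1:ℂ)^m)*(-1)^m) * (((-1:ℂ)^p)*(-1)^p) *
        (Complex.exp ((α : ℂ) * (z * (starRingEnd ℂ) z)) * gw α z) * evz z (hP α m p) := by ring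
    _ = _ := by rw [e, e2, e3]; ring

/-- conjugation on polynomials -/
noncomputable def sg : MvPolynomial (Fin 2) ℂ →+* MvPolynomial (Fin 2) ℂ :=
  MvPolynomial.eval₂Hom (MvPolynomial.C.comp (starRingEnd ℂ)) ![MvPolynomial.X 1, MvPolynomial.X 0]

lemma evz_sg (z : ℂ) (P : MvPolynomial (Fin 2) ℂ) :
    evz z (sg P) = (starRingEnd ℂ) (evz z P) := by
  induction P using MvPolynomial.induction_on with
  | C a => simp [evz, sg]
  | add P Q hP hQ => simp [hP, hQ]
  | mul_X P i hP =>
    rw [map_mul, map_mul, hP, map_mul, map_mul]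
    congr 1
    fin_cases i <;> simp [evz, sg]

lemma sg_pderiv (P : MvPolynomial (Fin 2) ℂ) :
    sg (MvPolynomial.pderiv 0 P) = MvPolynomial.pderiv 1 (sg P) := by
  induction P using MvPolynomial.induction_on with
  | C a => simp [sg]
  | add P Q hP hQ => simp [hP, hQ]
  | mul_X P i hP =>
    have : sg (MvPolynomial.pderiv 0 (MvPolynomial.X i))
        = MvPolynomial.pderiv 1 (sg (MvPolynomial.X i)) := by
      fin_cases i <;> simp [sg, MvPolynomial.pderiv_X]
    simp only [Derivation.leibniz, map_add, smul_eq_mul, map_mul, hP, this]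

lemma sg_hP (α : ℝ) (m p : ℕ) : sg (hP α m p) = gP α m p := by
  induction m with
  | zero => simp [hP, gP, sg]
  | succ n ih =>
    unfold hP gP at *
    rw [Function.iterate_succ_apply', Function.iterate_succ_apply', ← ih]
    simp only [D0, D1, map_sub, map_mul, sg_pderiv]
    simp [sg]

lemma pderiv0_gP (α : ℝ) (m p : ℕ) : MvPolynomial.pderiv 0 (gP α (m+1) p)
    = MvPolynomial.C ((α:ℂ) * (m+1)) * gP α m p ∧ MvPolynomial.pderiv 0 (gP α 0 p) = 0 := by
  have h0 : MvPolynomial.pderiv 0 (gP α 0 p) = 0 := by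
    simp [gP, Derivation.leibniz, Derivation.leibniz_pow, MvPolynomial.pderiv_X]
  have step : ∀ m, gP α (m+1) p = D1 α (gP α m p) := fun m => by
    rw [gP, Function.iterate_succ_apply', gP]
  have comm : ∀ P, MvPolynomial.pderiv 0 (D1 α P)
      = D1 α (MvPolynomial.pderiv 0 P) + MvPolynomial.C (α:ℂ) * P := fun P => by
    have : MvPolynomial.pderiv (0 : Fin 2) (MvPolynomial.pderiv 1 P)
      = MvPolynomial.pderiv 1 (MvPolynomial.pderiv 0 P) := by
      have hz : ⁅MvPolynomial.pderiv (R := ℂ) (0 : Fin 2), MvPolynomial.pderiv (R := ℂ) (1 : Fin 2)⁆ = 0 := by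
        apply MvPolynomial.derivation_ext
        intro i
        fin_cases i <;> simp [Derivation.commutator_apply, MvPolynomial.pderiv_X]
      have := congrArg (fun d => d P) hz
      simpa [Derivation.commutator_apply, sub_eq_zero] using this
    simp [D1, Derivation.leibniz, this, MvPolynomial.pderiv_X]
    ring
  refine ⟨?_, h0⟩
  induction m with
  | zero => rw [step, comm, h0]; simp [D1]
  | succ n ih =>
    rw [step, comm, ih, D1_smul, ← step]
    simp
    ring

lemma gw_eq (α : ℝ) (z : ℂ) : gw α z = ((Real.exp (-α * ‖z‖ ^ (2:ℝ)) : ℝ) : ℂ) := by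
  rw [gw, Complex.mul_conj, Complex.normSq_eq_norm_sq]
  push_cast
  norm_num

lemma moment_abs (α : ℝ) (hα : 0 < α) (n : ℕ) :
    ∫ z : ℂ, ‖z‖ ^ (n:ℝ) * Real.exp (-α * ‖z‖ ^ (2:ℝ))
      = Real.pi * α ^ (-((n:ℝ) + 2) / 2) * Real.Gamma (((n:ℝ) + 2) / 2) := by
  have hn : (0:ℝ) ≤ n := Nat.cast_nonneg n
  rw [Complex.integral_rpow_mul_exp_neg_mul_rpow (by norm_num) (by linarith) hα]
  ring

lemma integrable_abs (α : ℝ) (hα : 0 < α) (n : ℕ) :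
    Integrable (fun z : ℂ => ‖z‖ ^ (n:ℝ) * Real.exp (-α * ‖z‖ ^ (2:ℝ))) := by
  apply Integrable.of_integral_ne_zero
  rw [moment_abs α hα]
  have : 0 < Real.Gamma (((n:ℝ) + 2) / 2) := Real.Gamma_pos_of_pos (by positivity)
  positivity

lemma continuous_gw (α : ℝ) : Continuous (gw α) := by
  unfold gw; fun_prop

lemma integrable_mon (α : ℝ) (hα : 0 < α) (a b : ℕ) :
    Integrable (fun z : ℂ => z ^ a * (starRingEnd ℂ) z ^ b * gw α z) := by
  refine (integrable_abs α hα (a + b)).mono' ?_ ?_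
  · have := continuous_gw α
    exact Continuous.aestronglyMeasurable (by fun_prop)
  · refine Filter.Eventually.of_forall fun z => ?_
    rw [gw_eq, norm_mul, norm_mul, norm_pow, norm_pow, RCLike.norm_conj, ← pow_add,
      Complex.norm_real, Real.norm_of_nonneg (Real.exp_pos _).le, Real.rpow_natCast]

lemma moment_diag (α : ℝ) (hα : 0 < α) (a : ℕ) :
    ∫ z : ℂ, z ^ a * (starRingEnd ℂ) z ^ a * gw α z
      = (Real.pi : ℂ) * (a ! : ℂ) / (α:ℂ) ^ (a + 1) := by
  have h : ∀ z : ℂ, z ^ a * (starRingEnd ℂ) z ^ a * gw α z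
      = ((‖z‖ ^ ((2 * a : ℕ):ℝ) * Real.exp (-α * ‖z‖ ^ (2:ℝ)) : ℝ) : ℂ) := by
    intro z
    rw [gw_eq, ← mul_pow, Complex.mul_conj, Complex.normSq_eq_norm_sq, Real.rpow_natCast, pow_mul]
    push_cast
    ring
  simp_rw [h]
  rw [integral_complex_ofReal, moment_abs α hα]
  have e1 : (((2 * a : ℕ) : ℝ) + 2) / 2 = (a:ℝ) + 1 := by push_cast; ring
  have e2 : -(((2 * a : ℕ) : ℝ) + 2) / 2 = -(((a + 1 : ℕ)) : ℝ) := by push_cast; ring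
  rw [e1, e2, Real.Gamma_nat_eq_factorial, Real.rpow_neg hα.le, Real.rpow_natCast]
  push_cast
  field_simp

lemma moment_off (α : ℝ) (a b : ℕ) (hab : a ≠ b) :
    ∫ z : ℂ, z ^ a * (starRingEnd ℂ) z ^ b * gw α z = 0 := by
  set x : ℝ := Real.pi / ((a:ℝ) - b) with hx
  have hne : (a:ℝ) - b ≠ 0 := sub_ne_zero.2 (by exact_mod_cast hab)
  set R := rotation (Circle.exp x)
  have hR : ∀ z, R z = Complex.exp (x * Complex.I) * z := fun z => by
    simp [R, rotation_apply, Circle.coe_exp]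
  have h := (R.measurePreserving).integral_comp R.toHomeomorph.measurableEmbedding
    (fun z : ℂ => z ^ a * (starRingEnd ℂ) z ^ b * gw α z)
  have hc : Complex.exp (x * Complex.I) ^ a * (starRingEnd ℂ) (Complex.exp (x * Complex.I)) ^ b
      = -1 := by
    rw [← Complex.exp_conj, ← Complex.exp_nat_mul, ← Complex.exp_nat_mul, ← Complex.exp_add,
      ← Complex.exp_pi_mul_I]
    congr 1
    have : (x:ℂ) * ((a:ℂ) - b) = Real.pi := by
      rw [hx]
      exact_mod_cast div_mul_cancel₀ Real.pi hne
    simp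
    linear_combination Complex.I * this
  have h2 : ∀ z : ℂ, (R z) ^ a * (starRingEnd ℂ) (R z) ^ b * gw α (R z)
      = - (z ^ a * (starRingEnd ℂ) z ^ b * gw α z) := by
    intro z
    have : gw α (R z) = gw α z := by rw [gw_eq, gw_eq, R.norm_map]
    rw [this, hR, map_mul, mul_pow, mul_pow]
    linear_combination (z ^ a * (starRingEnd ℂ) z ^ b * gw α z) * hc
  simp only [h2, integral_neg] at h
  exact self_eq_neg.1 h.symm

/-- Gaussian expectation functional -/
noncomputable def EE (α : ℝ) (P : MvPolynomial (Fin 2) ℂ) : ℂ := ∫ z : ℂ, evz z P * gw α z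

lemma mon_eq (u : Fin 2 →₀ ℕ) (c : ℂ) : MvPolynomial.monomial u c
    = MvPolynomial.C c * (MvPolynomial.X 0 ^ u 0 * MvPolynomial.X 1 ^ u 1) := by
  rw [MvPolynomial.monomial_eq, Finsupp.prod_fintype _ _ (by simp), Fin.prod_univ_two]

lemma integrable_evz (α : ℝ) (hα : 0 < α) (P : MvPolynomial (Fin 2) ℂ) :
    Integrable (fun z => evz z P * gw α z) := by
  induction P using MvPolynomial.induction_on' with
  | monomial u c =>
    rw [mon_eq]
    refine ((integrable_mon α hα (u 0) (u 1)).const_mul c).congr ?_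
    refine Filter.Eventually.of_forall fun z => ?_
    simp only [map_mul, map_pow, evz_C, evz_X0, evz_X1]
    ring
  | add P Q hP hQ =>
    simp only [map_add, add_mul]
    exact hP.add hQ

lemma EE_add (α : ℝ) (hα : 0 < α) (P Q : MvPolynomial (Fin 2) ℂ) :
    EE α (P + Q) = EE α P + EE α Q := by
  simp only [EE, map_add, add_mul]
  exact integral_add (integrable_evz α hα P) (integrable_evz α hα Q)

lemma EE_C_mul (α : ℝ) (c : ℂ) (P : MvPolynomial (Fin 2) ℂ) :
    EE α (MvPolynomial.C c * P) = c * EE α P := by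
  simp only [EE, map_mul, evz_C, mul_assoc]
  exact integral_const_mul _ _

lemma EE_mon (α : ℝ) (hα : 0 < α) (a b : ℕ) :
    EE α (MvPolynomial.X 0 ^ a * MvPolynomial.X 1 ^ b)
      = if a = b then (Real.pi : ℂ) * (a ! : ℂ) / (α:ℂ) ^ (a + 1) else 0 := by
  simp only [EE, map_mul, map_pow, evz_X0, evz_X1]
  split_ifs with h
  · subst h; exact moment_diag α hα a
  · exact moment_off α a b h

lemma EE_pderiv0 (α : ℝ) (hα : 0 < α) (P : MvPolynomial (Fin 2) ℂ) :
    EE α (MvPolynomial.pderiv 0 P) = α * EE α (MvPolynomial.X 1 * P) := by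
  induction P using MvPolynomial.induction_on' with
  | monomial u c =>
    rw [mon_eq]
    generalize u 0 = a
    generalize u 1 = b
    have e1 : MvPolynomial.pderiv 0 (MvPolynomial.C c *
        (MvPolynomial.X 0 ^ a * MvPolynomial.X 1 ^ b) : MvPolynomial (Fin 2) ℂ)
        = MvPolynomial.C (c * a) * (MvPolynomial.X 0 ^ (a-1) * MvPolynomial.X 1 ^ b) := by
      simp [Derivation.leibniz, Derivation.leibniz_pow, MvPolynomial.pderiv_X]
      ring
    have e2 : MvPolynomial.X 1 * (MvPolynomial.C c *
        (MvPolynomial.X 0 ^ a * MvPolynomial.X 1 ^ b) : MvPolynomial (Fin 2) ℂ)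
        = MvPolynomial.C c * (MvPolynomial.X 0 ^ a * MvPolynomial.X 1 ^ (b+1)) := by ring
    have hα' : (α:ℂ) ≠ 0 := by exact_mod_cast hα.ne'
    rw [e1, e2, EE_C_mul, EE_C_mul, EE_mon α hα, EE_mon α hα]
    rcases a with _ | a
    · simp
    · simp only [Nat.add_sub_cancel, Nat.add_right_cancel_iff]
      split_ifs
      · rw [Nat.factorial_succ]; push_cast; field_simp; ring
      · simp
  | add P Q hP hQ =>
    rw [map_add, mul_add, EE_add α hα, EE_add α hα, hP, hQ]; ring

lemma EE_pderiv1 (α : ℝ) (hα : 0 < α) (P : MvPolynomial (Fin 2) ℂ) :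
    EE α (MvPolynomial.pderiv 1 P) = α * EE α (MvPolynomial.X 0 * P) := by
  induction P using MvPolynomial.induction_on' with
  | monomial u c =>
    rw [mon_eq]
    generalize u 0 = a
    generalize u 1 = b
    have e1 : MvPolynomial.pderiv 1 (MvPolynomial.C c *
        (MvPolynomial.X 0 ^ a * MvPolynomial.X 1 ^ b) : MvPolynomial (Fin 2) ℂ)
        = MvPolynomial.C (c * b) * (MvPolynomial.X 0 ^ a * MvPolynomial.X 1 ^ (b-1)) := by
      simp [Derivation.leibniz, Derivation.leibniz_pow, MvPolynomial.pderiv_X]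
      ring
    have e2 : MvPolynomial.X 0 * (MvPolynomial.C c *
        (MvPolynomial.X 0 ^ a * MvPolynomial.X 1 ^ b) : MvPolynomial (Fin 2) ℂ)
        = MvPolynomial.C c * (MvPolynomial.X 0 ^ (a+1) * MvPolynomial.X 1 ^ b) := by ring
    have hα' : (α:ℂ) ≠ 0 := by exact_mod_cast hα.ne'
    rw [e1, e2, EE_C_mul, EE_C_mul, EE_mon α hα, EE_mon α hα]
    rcases b with _ | b
    · simp
    · simp only [Nat.add_sub_cancel, Nat.add_right_cancel_iff]
      split_ifs with h
      · subst h; rw [Nat.factorial_succ]; push_cast; field_simp; ring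
      · simp
  | add P Q hP hQ =>
    rw [map_add, mul_add, EE_add α hα, EE_add α hα, hP, hQ]; ring

lemma EE_D0 (α : ℝ) (hα : 0 < α) (P Q : MvPolynomial (Fin 2) ℂ) :
    EE α (D0 α P * Q) = EE α (P * MvPolynomial.pderiv 0 Q) := by
  have h := EE_pderiv0 α hα (P * Q)
  rw [Derivation.leibniz, EE_add α hα, smul_eq_mul, smul_eq_mul] at h
  have e : P * MvPolynomial.pderiv 0 Q + D0 α P * Q + Q * MvPolynomial.pderiv 0 P
      = P * MvPolynomial.pderiv 0 Q + MvPolynomial.C (α:ℂ) * (MvPolynomial.X 1 * (P * Q)) := by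
    rw [D0]; ring
  have h2 := congrArg (EE α) e
  rw [EE_add α hα, EE_add α hα, EE_add α hα, EE_C_mul] at h2
  linear_combination h2 - h

lemma EE_D1 (α : ℝ) (hα : 0 < α) (P Q : MvPolynomial (Fin 2) ℂ) :
    EE α (P * D1 α Q) = EE α (MvPolynomial.pderiv 1 P * Q) := by
  have h := EE_pderiv1 α hα (P * Q)
  rw [Derivation.leibniz, EE_add α hα, smul_eq_mul, smul_eq_mul] at h
  have e : P * MvPolynomial.pderiv 1 Q + P * D1 α Q + MvPolynomial.pderiv 1 P * Q
      = MvPolynomial.pderiv 1 P * Q + MvPolynomial.C (α:ℂ) * (MvPolynomial.X 0 * (P * Q)) := by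
    rw [D1]; ring
  have h2 := congrArg (EE α) e
  rw [EE_add α hα, EE_add α hα, EE_add α hα, EE_C_mul] at h2
  rw [mul_comm Q] at h
  linear_combination h2 - h

lemma EE_hP_gP (α : ℝ) (hα : 0 < α) (p p' m m' : ℕ) :
    EE α (hP α m p * gP α m' p')
      = if m = m' ∧ p = p' then
          (Real.pi : ℂ) * (α:ℂ) ^ (m + p) / α * (m ! : ℂ) * (p ! : ℂ) else 0 := by
  have hα' : (α:ℂ) ≠ 0 := by exact_mod_cast hα.ne'
  induction m generalizing m' with
  | zero =>
    rcases m' with _ | m'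
    · have e : hP α 0 p * gP α 0 p' = MvPolynomial.C ((α:ℂ) ^ p * (α:ℂ) ^ p') *
          (MvPolynomial.X 0 ^ p * MvPolynomial.X 1 ^ p') := by
        simp [hP, gP]; ring
      rw [e, EE_C_mul, EE_mon α hα]
      by_cases h : p = p'
      · subst h; simp; field_simp; ring
      · simp [h]
    · have e : gP α (m'+1) p' = D1 α (gP α m' p') := by
        rw [gP, Function.iterate_succ_apply', gP]
      have e2 : MvPolynomial.pderiv 1 (hP α 0 p) = 0 := by
        simp [hP, Derivation.leibniz, Derivation.leibniz_pow, MvPolynomial.pderiv_X]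
      rw [e, EE_D1 α hα, e2]
      simp [EE]
  | succ m ih =>
    have e : hP α (m+1) p = D0 α (hP α m p) := by
      rw [hP, Function.iterate_succ_apply', hP]
    rw [e, EE_D0 α hα]
    rcases m' with _ | m'
    · rw [(pderiv0_gP α 0 p').2]; simp [EE]
    · rw [(pderiv0_gP α m' p').1, mul_left_comm, EE_C_mul, ih]
      simp only [Nat.add_right_cancel_iff]
      split_ifs with h
      · rw [h.1, Nat.factorial_succ]; push_cast; ring
      · simp

theorem cHermite_orthogonality (α : ℝ) (hα : 0 < α) (m p m' p' : ℕ) :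
    ∫ z : ℂ, cHermite α m p z * (starRingEnd ℂ) (cHermite α m' p' z)
        * Complex.exp (-(α : ℂ) * (z * (starRingEnd ℂ) z))
      = if m = m' ∧ p = p' then
          ((Real.pi * α ^ ((p : ℤ) + (m : ℤ) - 1) * (m ! : ℝ) * (p ! : ℝ) : ℝ) : ℂ)
        else 0 := by
  have hα' : (α:ℂ) ≠ 0 := by exact_mod_cast hα.ne'
  have h := EE_hP_gP α hα p p' m m'
  have e : ∀ z, cHermite α m p z * (starRingEnd ℂ) (cHermite α m' p' z)
        * Complex.exp (-(α : ℂ) * (z * (starRingEnd ℂ) z))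
      = evz z (hP α m p * gP α m' p') * gw α z := fun z => by
    rw [cHermite_eq, cHermite_eq, map_mul, ← sg_hP, evz_sg, gw]
  simp only [e]
  rw [EE] at h
  rw [h]
  split_ifs
  · push_cast
    rw [zpow_sub₀ hα', ← Nat.cast_add, zpow_natCast, zpow_one, add_comm p m]
    ring
  · rfl
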